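/- Let p ≥ 1, let Θ ⊆ [0,1]^p be convex and compact with Θ_bin := Θ ∩ {0,1}^p nonempty, let Λ ⊆ ℝ^m be nonempty and compact, and let G : ℝ^m × ℝ^p → ℝ be continuous on Λ × Θ with θ ↦ G(λ,θ) L-Lipschitz on Θ (Euclidean norm) for every λ ∈ Λ, where L > 0. Let (ε_k)_{k∈ℕ} be a sequence of positive reals converging to 0, and for every k let (λ^k, θ^k) be a local minimizer on Λ × Θ of (λ,θ) ↦ G(λ,θ) + (1/ε_k)·φ(θ). If liminf_{k→∞} dist_∞(θ^k, Θ_bin) < 1/2, then there exists k ∈ ℕ such that θ^k ∈ Θ_bin. -/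

import Mathlib

open scoped BigOperators
open Filter

/-- The concave penalty function `φ(θ) = ∑ i, θ i (1 - θ i)`. -/
noncomputable def phi {p : ℕ} (θ : EuclideanSpace ℝ (Fin p)) : ℝ :=
  ∑ i, θ i * (1 - θ i)

/-- The distance from a point to a set measured in the supremum norm. -/
noncomputable def supDist {p : ℕ} (x : EuclideanSpace ℝ (Fin p))
    (S : Set (EuclideanSpace ℝ (Fin p))) : ℝ :=
  sInf ((fun s => ⨆ i, |x i - s i|) '' S)

/-- The Euclidean norm is at most the `ℓ¹` norm. -/
theorem EuclideanSpace.norm_le_sum_abs {p : ℕ} (x : EuclideanSpace ℝ (Fin p)) :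
    ‖x‖ ≤ ∑ i, |x i| := by
  rw [EuclideanSpace.norm_eq]
  refine Real.sqrt_le_iff.mpr ⟨Finset.sum_nonneg fun i _ => abs_nonneg _, ?_⟩
  simpa only [Real.norm_eq_abs] using
    Finset.sum_sq_le_sq_sum_of_nonneg fun i (_ : i ∈ Finset.univ) => abs_nonneg (x i)

theorem abs_sub_le_iSup {p : ℕ} (x s : EuclideanSpace ℝ (Fin p)) (i : Fin p) :
    |x i - s i| ≤ ⨆ j, |x j - s j| :=
  le_ciSup (f := fun j => |x j - s j|) (Set.finite_range _).bddAbove i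

theorem supDist_le_one {p : ℕ} {x : EuclideanSpace ℝ (Fin p)}
    {S : Set (EuclideanSpace ℝ (Fin p))} (hS : S.Nonempty)
    (hx : ∀ i, x i ∈ Set.Icc (0 : ℝ) 1) (hS01 : ∀ s ∈ S, ∀ i, s i ∈ Set.Icc (0 : ℝ) 1) :
    supDist x S ≤ 1 := by
  obtain ⟨s, hs⟩ := hS
  have hbdd : BddBelow ((fun s => ⨆ i, |x i - s i|) '' S) := by
    refine ⟨0, ?_⟩
    rintro _ ⟨y, -, rfl⟩
    exact Real.iSup_nonneg fun i => abs_nonneg _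
  refine (csInf_le hbdd ⟨s, hs, rfl⟩).trans (Real.iSup_le (fun i => ?_) zero_le_one)
  have h1 := hx i
  have h2 := hS01 s hs i
  exact abs_le.mpr ⟨by linarith [h1.1, h2.2], by linarith [h1.2, h2.1]⟩

theorem exists_abs_sub_lt_of_supDist_lt {p : ℕ} {x : EuclideanSpace ℝ (Fin p)}
    {S : Set (EuclideanSpace ℝ (Fin p))} (hS : S.Nonempty) {c : ℝ} (h : supDist x S < c) :
    ∃ s ∈ S, ∀ i, |x i - s i| < c := by
  obtain ⟨_, ⟨s, hs, rfl⟩, hlt⟩ := exists_lt_of_csInf_lt (hS.image _) h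
  exact ⟨s, hs, fun i => (abs_sub_le_iSup x s i).trans_lt hlt⟩

/-- Moving towards a binary point at sup-distance at most `c` decreases the penalty at least at
rate `1 - 2 c` times the `ℓ¹` distance. -/
theorem phi_lineMap_le {p : ℕ} {x s : EuclideanSpace ℝ (Fin p)} {c t : ℝ}
    (hx : ∀ i, x i ∈ Set.Icc (0 : ℝ) 1) (hs : ∀ i, s i = 0 ∨ s i = 1)
    (hc : ∀ i, |x i - s i| ≤ c) (ht : 0 ≤ t) :
    phi (x + t • (s - x)) ≤ phi x - t * (1 - 2 * c) * ∑ i, |(s - x) i| := by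
  unfold phi
  rw [Finset.mul_sum, ← Finset.sum_sub_distrib]
  refine Finset.sum_le_sum fun i _ => ?_
  have hxi := hx i
  have hci := hc i
  simp only [PiLp.add_apply, PiLp.smul_apply, PiLp.sub_apply, smul_eq_mul]
  rcases hs i with h | h
  · rw [h] at hci ⊢
    rw [sub_zero, abs_of_nonneg hxi.1] at hci
    rw [zero_sub, abs_neg, abs_of_nonneg hxi.1]
    nlinarith [mul_nonneg (mul_nonneg ht hxi.1) (sub_nonneg.mpr hci), sq_nonneg (t * x i)]
  · rw [h] at hci ⊢
    have hxi' := sub_nonneg.mpr hxi.2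
    rw [abs_sub_comm, abs_of_nonneg hxi'] at hci
    rw [abs_of_nonneg hxi']
    nlinarith [mul_nonneg (mul_nonneg ht hxi') (sub_nonneg.mpr hci),
      sq_nonneg (t * (1 - x i))]

/-- If the penalty weight exceeds `L / (1 - 2 c)`, a local minimizer of the penalized function at
sup-distance at most `c` from a feasible binary point equals that point. -/
theorem eq_of_isLocalMin_penalized {p : ℕ} {Θ : Set (EuclideanSpace ℝ (Fin p))}
    (hΘ : Convex ℝ Θ) {g : EuclideanSpace ℝ (Fin p) → ℝ} {L w c ρ : ℝ} (hL : 0 ≤ L)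
    (hg : LipschitzOnWith L.toNNReal g Θ) {x s : EuclideanSpace ℝ (Fin p)}
    (hxΘ : x ∈ Θ) (hsΘ : s ∈ Θ) (hx : ∀ i, x i ∈ Set.Icc (0 : ℝ) 1)
    (hs : ∀ i, s i = 0 ∨ s i = 1) (hc : ∀ i, |x i - s i| ≤ c) (hc2 : 2 * c ≤ 1)
    (hw : 0 ≤ w) (hLw : L < w * (1 - 2 * c)) (hρ : 0 < ρ)
    (hmin : ∀ y ∈ Θ, dist y x ≤ ρ → g x + w * phi x ≤ g y + w * phi y) :
    x = s := by
  by_contra hne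
  have hd : 0 < ‖s - x‖ := norm_pos_iff.mpr (sub_ne_zero.mpr (Ne.symm hne))
  obtain ⟨t, ht, ht1, htρ⟩ : ∃ t : ℝ, 0 < t ∧ t ≤ 1 ∧ t * ‖s - x‖ ≤ ρ :=
    ⟨min 1 (ρ / ‖s - x‖), lt_min one_pos (div_pos hρ hd), min_le_left _ _,
      (le_div_iff₀ hd).mp (min_le_right _ _)⟩
  have hy : x + t • (s - x) ∈ Θ := hΘ.add_smul_sub_mem hxΘ hsΘ ⟨ht.le, ht1⟩
  have hdist : dist (x + t • (s - x)) x = t * ‖s - x‖ := by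
    rw [dist_eq_norm, add_sub_cancel_left, norm_smul, Real.norm_of_nonneg ht.le]
  have hle := hmin _ hy (hdist.trans_le htρ)
  have hG := hg.dist_le_mul _ hy _ hxΘ
  rw [hdist, Real.coe_toNNReal _ hL, Real.dist_eq] at hG
  have hG' := (le_abs_self _).trans hG
  have hphi : phi (x + t • (s - x)) ≤ phi x - t * (1 - 2 * c) * ‖s - x‖ :=
    (phi_lineMap_le hx hs hc ht.le).trans <| sub_le_sub_left
      (mul_le_mul_of_nonneg_left (EuclideanSpace.norm_le_sum_abs _)
        (mul_nonneg ht.le (by linarith))) _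
  have hwphi := mul_le_mul_of_nonneg_left hphi hw
  have hpos := mul_pos (mul_pos ht hd) (sub_pos.mpr hLw)
  nlinarith

/-- If `ε_k → 0`, `(λ^k, θ^k)` are local minimizers of `G + (1/ε_k) φ` on `Λ × Θ`, and
`liminf_k dist_∞(θ^k, Θ_bin) < 1/2`, then some `θ^k` lies in `Θ_bin`. -/
theorem penalty_method_binary_iterate {m p : ℕ} (hp : 1 ≤ p)
    (Θ : Set (EuclideanSpace ℝ (Fin p)))
    (hΘsub : Θ ⊆ {θ | ∀ i, θ i ∈ Set.Icc (0 : ℝ) 1})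
    (hΘconv : Convex ℝ Θ) (hΘcomp : IsCompact Θ)
    (Θbin : Set (EuclideanSpace ℝ (Fin p)))
    (hΘbin : Θbin = Θ ∩ {θ | ∀ i, θ i = 0 ∨ θ i = 1})
    (hΘbinne : Θbin.Nonempty)
    (Λ : Set (EuclideanSpace ℝ (Fin m))) (hΛne : Λ.Nonempty) (hΛcomp : IsCompact Λ)
    (G : EuclideanSpace ℝ (Fin m) → EuclideanSpace ℝ (Fin p) → ℝ)
    (hGcont : ContinuousOn
      (fun x : EuclideanSpace ℝ (Fin m) × EuclideanSpace ℝ (Fin p) => G x.1 x.2) (Λ ×ˢ Θ))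
    (L : ℝ) (hL : 0 < L)
    (hLip : ∀ lam ∈ Λ, LipschitzOnWith L.toNNReal (G lam) Θ)
    (ε : ℕ → ℝ) (hεpos : ∀ k, 0 < ε k) (hεlim : Tendsto ε atTop (nhds 0))
    (lamSeq : ℕ → EuclideanSpace ℝ (Fin m)) (θSeq : ℕ → EuclideanSpace ℝ (Fin p))
    (hmem : ∀ k, (lamSeq k, θSeq k) ∈ Λ ×ˢ Θ)
    (hlocmin : ∀ k, ∃ ρ > (0 : ℝ), ∀ y ∈ Λ ×ˢ Θ, dist y (lamSeq k, θSeq k) ≤ ρ →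
      G (lamSeq k) (θSeq k) + (1 / ε k) * phi (θSeq k) ≤ G y.1 y.2 + (1 / ε k) * phi y.2)
    (hliminf : Filter.liminf (fun k => supDist (θSeq k) Θbin) atTop < 1 / 2) :
    ∃ k : ℕ, θSeq k ∈ Θbin := by
  subst hΘbin
  have h01 : ∀ s ∈ Θ ∩ {θ | ∀ i, θ i = 0 ∨ θ i = 1}, ∀ i, s i ∈ Set.Icc (0 : ℝ) 1 :=
    fun s hs => hΘsub hs.1
  have hθ01 : ∀ k, ∀ i, θSeq k i ∈ Set.Icc (0 : ℝ) 1 := fun k => hΘsub (hmem k).2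
  obtain ⟨c, hcl, hc⟩ := exists_between hliminf
  have hfreq := frequently_lt_of_liminf_lt
    (isBoundedUnder_of ⟨1, fun k => supDist_le_one hΘbinne (hθ01 k) h01⟩ :
      IsBoundedUnder (· ≤ ·) atTop _).isCoboundedUnder_ge hcl
  have hεsmall : ∀ᶠ k in atTop, ε k < (1 - 2 * c) / L :=
    hεlim.eventually_lt_const (div_pos (by linarith) hL)
  obtain ⟨k, hk, hεk⟩ := (hfreq.and_eventually hεsmall).exists
  obtain ⟨s, hs, hsc⟩ := exists_abs_sub_lt_of_supDist_lt hΘbinne hk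
  obtain ⟨ρ, hρ, hmin⟩ := hlocmin k
  have hLw : L < 1 / ε k * (1 - 2 * c) := by
    rw [one_div_mul_eq_div, lt_div_iff₀ (hεpos k), mul_comm]
    exact (lt_div_iff₀ hL).mp hεk
  have hmin' : ∀ y ∈ Θ, dist y (θSeq k) ≤ ρ →
      G (lamSeq k) (θSeq k) + 1 / ε k * phi (θSeq k) ≤ G (lamSeq k) y + 1 / ε k * phi y :=
    fun y hy hdist => hmin (lamSeq k, y) ⟨(hmem k).1, hy⟩
      (by simpa [Prod.dist_eq, hρ.le] using hdist)
  have heq : θSeq k = s :=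
    eq_of_isLocalMin_penalized hΘconv hL.le (hLip _ (hmem k).1) (hmem k).2 hs.1 (hθ01 k) hs.2
      (fun i => (hsc i).le) (by linarith) (one_div_pos.mpr (hεpos k)).le hLw hρ hmin'
  exact ⟨k, heq ▸ hs⟩
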